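/- Let k be a field with char(k) = 2. Then every 2-dimensional unital associative k-algebra is isomorphic to one of: k_(0,0), k_(c,1) for some c ∈ k, or (only possible when k ≠ k²) k_(δ,0) for some non-square δ ∈ k \ k². Moreover: k_(a,0) ≅ k_(0,0) if and only if a ∈ k²; for non-squares δ, δ', k_(δ,0) ≅ k_(δ',0) if and only if there exists q ∈ k* with δ − q² δ' ∈ k²; k_(c,1) ≅ k_(c',1) if and only if c − c' ∈ {α² − α : α ∈ k}; and no algebra k_(c,1) is isomorphic to any k_(a,0). In particular, if k = k² the isomorphism classes are represented by k_(0,0) together with the k_(c,1) for c ranging over a system of representatives of k modulo the relation c ≡ c' iff c − c' ∈ {α² − α : α ∈ k}, and if k ≠ k² one adds the classes k_(δ,0) for δ ranging over a system of representatives of k \ k² modulo the relation δ ≡ δ' iff δ − q² δ' ∈ k² for some q ∈ k*. -/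

import Mathlib

universe u v

open Polynomial

/-- The 2-dimensional algebra `k_(a,b) = k[X]/(X² − bX − a)`, with basis `{1, x}` and
`x² = a·1 + b·x`. -/
noncomputable abbrev kTwoDim (k : Type u) [Field k] (a b : k) : Type u :=
  AdjoinRoot (X ^ 2 - C b * X - C a : Polynomial k)

section QuadraticAlgebras

variable {k : Type u} [Field k]

theorem kTwoDim_natDegree (a b : k) : (X ^ 2 - C b * X - C a : k[X]).natDegree = 2 := by
  compute_degree!

theorem kTwoDim_ne_zero (a b : k) : (X ^ 2 - C b * X - C a : k[X]) ≠ 0 := by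
  intro h
  simpa [h] using kTwoDim_natDegree a b

theorem finrank_kTwoDim (a b : k) : Module.finrank k (kTwoDim k a b) = 2 := by
  rw [(AdjoinRoot.powerBasis (kTwoDim_ne_zero a b)).finrank, AdjoinRoot.powerBasis_dim,
    kTwoDim_natDegree]

/-- The generator `x` of `k_(a,b)`. -/
noncomputable def kTwoDimGen (a b : k) : kTwoDim k a b :=
  AdjoinRoot.root _

theorem kTwoDimGen_sq (a b : k) :
    kTwoDimGen a b ^ 2 =
      algebraMap k (kTwoDim k a b) a + algebraMap k (kTwoDim k a b) b * kTwoDimGen a b := by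
  have h := AdjoinRoot.eval₂_root (X ^ 2 - C b * X - C a : k[X])
  simp only [eval₂_sub, eval₂_mul, eval₂_pow, eval₂_X, eval₂_C] at h
  simp only [AdjoinRoot.algebraMap_eq]
  unfold kTwoDimGen
  linear_combination h

theorem kTwoDimGen_notMem_range (a b : k) :
    kTwoDimGen a b ∉ Set.range (algebraMap k (kTwoDim k a b)) := by
  rintro ⟨r, hr⟩
  have h : AdjoinRoot.mk (X ^ 2 - C b * X - C a : k[X]) (X - C r) = 0 := by
    rw [map_sub, AdjoinRoot.mk_X, AdjoinRoot.mk_C, sub_eq_zero]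
    exact hr.symm
  have := natDegree_le_of_dvd (AdjoinRoot.mk_eq_zero.mp h) (X_sub_C_ne_zero r)
  rw [kTwoDim_natDegree, natDegree_X_sub_C] at this
  omega

variable {B : Type v} [Ring B] [Algebra k B]

theorem linearIndependent_one_pair [Nontrivial B] {y : B}
    (hy : y ∉ Set.range (algebraMap k B)) : LinearIndependent k ![(1 : B), y] := by
  refine (LinearIndependent.pair_iff' one_ne_zero).2 fun r hr => hy ⟨r, ?_⟩
  rw [Algebra.algebraMap_eq_smul_one, hr]

theorem nontrivial_of_finrank_eq_two (hB : Module.finrank k B = 2) : Nontrivial B :=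
  Module.nontrivial_of_finrank_pos (R := k) (by omega)

theorem exists_eq_add_mul_of_finrank_eq_two (hB : Module.finrank k B = 2) {y : B}
    (hy : y ∉ Set.range (algebraMap k B)) (z : B) :
    ∃ p q : k, z = algebraMap k B p + algebraMap k B q * y := by
  have := nontrivial_of_finrank_eq_two hB
  have hspan := (linearIndependent_one_pair hy).span_eq_top_of_card_eq_finrank (by simp [hB])
  have hz : z ∈ Submodule.span k (Set.range ![(1 : B), y]) := hspan ▸ Submodule.mem_top
  rw [Matrix.range_cons_cons_empty, Submodule.mem_span_pair] at hz
  obtain ⟨p, q, rfl⟩ := hz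
  exact ⟨p, q, by rw [Algebra.algebraMap_eq_smul_one, ← Algebra.smul_def]⟩

theorem eq_and_eq_of_add_mul_eq [Nontrivial B] {y : B} (hy : y ∉ Set.range (algebraMap k B))
    {p q r s : k} (h : algebraMap k B p + algebraMap k B q * y =
      algebraMap k B r + algebraMap k B s * y) : p = r ∧ q = s := by
  refine (linearIndependent_one_pair hy).eq_of_pair ?_
  simpa only [Algebra.algebraMap_eq_smul_one, smul_mul_assoc, one_mul] using h

theorem exists_notMem_range_algebraMap (hB : Module.finrank k B = 2) :
    ∃ y : B, y ∉ Set.range (algebraMap k B) := by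
  by_contra! h
  have hle : Module.finrank k B ≤ 1 := finrank_le_one (1 : B) fun w => by
    obtain ⟨r, hr⟩ := h w
    exact ⟨r, by rw [← hr, Algebra.algebraMap_eq_smul_one]⟩
  omega

/-- A 2-dimensional algebra is isomorphic to `k_(a,b)` iff it contains a non-scalar `y` with
`y² = a + b y`. -/
theorem nonempty_algEquiv_kTwoDim_iff (hB : Module.finrank k B = 2) (a b : k) :
    Nonempty (B ≃ₐ[k] kTwoDim k a b) ↔ ∃ y : B, y ∉ Set.range (algebraMap k B) ∧
      y ^ 2 = algebraMap k B a + algebraMap k B b * y := by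
  constructor
  · rintro ⟨e⟩
    refine ⟨e.symm (kTwoDimGen a b), ?_, ?_⟩
    · rintro ⟨r, hr⟩
      refine kTwoDimGen_notMem_range a b ⟨r, ?_⟩
      rw [← e.apply_symm_apply (kTwoDimGen a b), ← hr, e.commutes]
    · rw [← map_pow, kTwoDimGen_sq, map_add, map_mul, e.symm.commutes, e.symm.commutes]
  · rintro ⟨y, hy, hsq⟩
    let f : kTwoDim k a b →ₐ[k] B :=
      Ideal.Quotient.liftₐ (Ideal.span {X ^ 2 - C b * X - C a}) (aeval y) (by
        intro g hg
        obtain ⟨c, rfl⟩ := Ideal.mem_span_singleton'.1 hg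
        simp [hsq])
    have hf : f (kTwoDimGen a b) = y := aeval_X y
    have hsurj : Function.Surjective f := fun z => by
      obtain ⟨p, q, rfl⟩ := exists_eq_add_mul_of_finrank_eq_two hB hy z
      exact ⟨algebraMap k _ p + algebraMap k _ q * kTwoDimGen a b, by
        simp only [map_add, map_mul, f.commutes, hf]⟩
    have : FiniteDimensional k (kTwoDim k a b) :=
      FiniteDimensional.of_finrank_pos (by rw [finrank_kTwoDim]; norm_num)
    have : FiniteDimensional k B := FiniteDimensional.of_finrank_pos (by omega)
    have hinj : Function.Injective f :=
      (LinearMap.injective_iff_surjective_of_finrank_eq_finrank (f := f.toLinearMap)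
        (by rw [finrank_kTwoDim, hB])).2 hsurj
    exact ⟨(AlgEquiv.ofBijective f ⟨hinj, hsurj⟩).symm⟩

theorem exists_nonempty_algEquiv_kTwoDim (hB : Module.finrank k B = 2) :
    ∃ a b : k, Nonempty (B ≃ₐ[k] kTwoDim k a b) := by
  obtain ⟨y, hy⟩ := exists_notMem_range_algebraMap hB
  obtain ⟨a, b, h⟩ := exists_eq_add_mul_of_finrank_eq_two hB hy (y ^ 2)
  exact ⟨a, b, (nonempty_algEquiv_kTwoDim_iff hB a b).2 ⟨y, hy, h⟩⟩

/-- `k_(a',b') ≅ k_(a,b)` iff some `p + q x'` with `q ≠ 0` satisfies the equation of `x`. -/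
theorem kTwoDim_algEquiv_iff (a b a' b' : k) :
    Nonempty (kTwoDim k a' b' ≃ₐ[k] kTwoDim k a b) ↔
      ∃ p q : k, q ≠ 0 ∧ b = 2 * p + q * b' ∧ a + b * p = p ^ 2 + q ^ 2 * a' := by
  have hB := finrank_kTwoDim a' b'
  have hx := kTwoDimGen_notMem_range a' b'
  have hx2 := kTwoDimGen_sq a' b'
  have := nontrivial_of_finrank_eq_two hB
  rw [nonempty_algEquiv_kTwoDim_iff hB]
  generalize kTwoDimGen a' b' = x at hx hx2
  constructor
  · rintro ⟨y, hy, hsq⟩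
    obtain ⟨p, q, rfl⟩ := exists_eq_add_mul_of_finrank_eq_two hB hx y
    have hq : q ≠ 0 := by
      rintro rfl
      exact hy ⟨p, by simp⟩
    obtain ⟨h₁, h₂⟩ := eq_and_eq_of_add_mul_eq hx
      (p := a + b * p) (q := b * q) (r := p ^ 2 + q ^ 2 * a')
      (s := (2 * p + q * b') * q) (by
        simp only [map_add, map_mul, map_pow, map_ofNat]
        linear_combination -hsq + (algebraMap k _ q) ^ 2 * hx2)
    exact ⟨p, q, hq, mul_right_cancel₀ hq h₂, h₁⟩
  · rintro ⟨p, q, hq, hb, ha⟩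
    refine ⟨algebraMap k _ p + algebraMap k _ q * x, ?_, ?_⟩
    · rintro ⟨r, hr⟩
      exact hq (eq_and_eq_of_add_mul_eq hx (p := p) (q := q) (r := r) (s := 0)
        (by rw [← hr]; simp)).2
    · have hb' := congrArg (algebraMap k (kTwoDim k a' b')) hb
      have ha' := congrArg (algebraMap k (kTwoDim k a' b')) ha
      simp only [map_add, map_mul, map_pow, map_ofNat] at hb' ha'
      linear_combination (algebraMap k _ q) ^ 2 * hx2 - ha' - algebraMap k _ q * x * hb'

end QuadraticAlgebras

/-- **Corollary 3.5 (4)–(5)**.  Classification of 2-dimensional unital associative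
algebras over a field `k` of characteristic 2. -/
theorem two_dimensional_algebras_char_two (k : Type u) [Field k]
    (hchar : ringChar k = 2) :
    -- every 2-dimensional algebra is isomorphic to `k_(0,0)`, some `k_(c,1)`, or
    -- (only possible when `k ≠ k²`) some `k_(δ,0)` with `δ` a non-square
    (∀ (B : Type v) (_ : Ring B) (_ : Algebra k B), Module.finrank k B = 2 →
      Nonempty (B ≃ₐ[k] kTwoDim k 0 0) ∨ (∃ c : k, Nonempty (B ≃ₐ[k] kTwoDim k c 1)) ∨
        ∃ δ : k, (∀ q : k, q ^ 2 ≠ δ) ∧ Nonempty (B ≃ₐ[k] kTwoDim k δ 0)) ∧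
    -- `k_(a,0) ≅ k_(0,0)` iff `a` is a square
    (∀ a : k, Nonempty (kTwoDim k a 0 ≃ₐ[k] kTwoDim k 0 0) ↔ ∃ q : k, q ^ 2 = a) ∧
    -- for non-squares `δ, δ'`: `k_(δ,0) ≅ k_(δ',0)` iff `δ − q²δ' ∈ k²` for some `q ∈ k*`
    (∀ δ δ' : k, (∀ q : k, q ^ 2 ≠ δ) → (∀ q : k, q ^ 2 ≠ δ') →
      (Nonempty (kTwoDim k δ 0 ≃ₐ[k] kTwoDim k δ' 0) ↔
        ∃ q : k, q ≠ 0 ∧ ∃ s : k, δ - q ^ 2 * δ' = s ^ 2)) ∧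
    -- `k_(c,1) ≅ k_(c',1)` iff `c − c' = α² − α` for some `α ∈ k`
    (∀ c c' : k, Nonempty (kTwoDim k c 1 ≃ₐ[k] kTwoDim k c' 1) ↔
      ∃ α : k, c - c' = α ^ 2 - α) ∧
    -- no `k_(c,1)` is isomorphic to any `k_(a,0)`
    (∀ c a : k, IsEmpty (kTwoDim k c 1 ≃ₐ[k] kTwoDim k a 0)) := by
  have h2 : (2 : k) = 0 := by
    have := ringChar.Nat.cast_ringChar (R := k)
    rwa [hchar, Nat.cast_ofNat] at this
  simp only [← not_nonempty_iff, kTwoDim_algEquiv_iff, h2, zero_mul, zero_add, mul_zero, mul_one,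
    add_zero, one_mul]
  refine ⟨fun B _ _ hB => ?_, fun a => ?_, fun δ δ' _ _ => ?_, fun c c' => ?_, fun c a => ?_⟩
  · obtain ⟨a, b, ⟨e⟩⟩ := exists_nonempty_algEquiv_kTwoDim hB
    by_cases hb : b = 0
    · subst hb
      by_cases ha : ∃ q : k, q ^ 2 = a
      · obtain ⟨q, rfl⟩ := ha
        obtain ⟨e'⟩ := (kTwoDim_algEquiv_iff 0 0 (q ^ 2) 0).2
          ⟨q, 1, one_ne_zero, by linear_combination -q * h2, by linear_combination -q ^ 2 * h2⟩
        exact Or.inl ⟨e.trans e'⟩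
      · exact Or.inr (Or.inr ⟨a, not_exists.1 ha, ⟨e⟩⟩)
    · obtain ⟨e'⟩ := (kTwoDim_algEquiv_iff (a / b ^ 2) 1 a b).2
        ⟨0, b⁻¹, inv_ne_zero hb, by field_simp; ring, by field_simp; ring⟩
      exact Or.inr (Or.inl ⟨_, ⟨e.trans e'⟩⟩)
  · constructor
    · rintro ⟨p, q, hq, -, h⟩
      refine ⟨p / q, ?_⟩
      field_simp
      linear_combination -h - q ^ 2 * a * h2
    · rintro ⟨q, rfl⟩
      exact ⟨q, 1, one_ne_zero, trivial, by linear_combination -q ^ 2 * h2⟩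
  · constructor
    · rintro ⟨p, q, hq, -, h⟩
      refine ⟨q⁻¹, inv_ne_zero hq, p / q, ?_⟩
      field_simp
      linear_combination -h - p ^ 2 * h2
    · rintro ⟨q, hq, s, h⟩
      refine ⟨s / q, q⁻¹, inv_ne_zero hq, trivial, ?_⟩
      field_simp
      linear_combination -h - s ^ 2 * h2
  · constructor
    · rintro ⟨p, q, -, rfl, h⟩
      exact ⟨p, by linear_combination -h + (p - p ^ 2) * h2⟩
    · rintro ⟨p, h⟩
      exact ⟨p, 1, one_ne_zero, rfl, by linear_combination -h + (p - p ^ 2) * h2⟩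
  · rintro ⟨p, q, hq, h, -⟩
    exact hq h.symm
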